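/- arXiv:2105.13462 — 2 statements merged into one kernel-verified Lean document; each statement's English description precedes it below -/
import Mathlib

section
/- Let f̃ : ℝ^m × ℝ^p → ℝ be differentiable, W₁ ∈ ℝ^{m×d}, W₂ ∈ ℝ^p, and x ∈ ℝ^d with x ≠ 0. Then the gradient of x ↦ f̃(W₁x, W₂) satisfies ‖∇_x f̃(W₁x, W₂)‖₂ ≤ (‖W₁‖₂ / ‖x‖₂) · ‖∇_{W₁} f̃(W₁x, W₂)‖₂, where ∇_{W₁} f̃(W₁x, W₂) denotes the gradient of the map V ↦ f̃(Vx, W₂) at V = W₁, whose ℓ² norm is the Frobenius-type norm of the gradient matrix (∂f̃/∂(W₁x))(W₁x, W₂) · xᵀ. -/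
/-- Matrix–vector product of `W : ℝ^{m×d}` (as a function) with `x : ℝ^d`. -/
noncomputable def mVec {m d : ℕ} (W : Fin m → Fin d → ℝ) (x : Fin d → ℝ) : Fin m → ℝ :=
  fun r => ∑ s, W r s * x s

/-- Euclidean (ℓ²) norm of a vector in `ℝ^d`. -/
noncomputable def l2norm {d : ℕ} (v : Fin d → ℝ) : ℝ := Real.sqrt (∑ j, v j ^ 2)

/-- Operator norm of a matrix induced by Euclidean norms. -/
noncomputable def opNorm2 {m d : ℕ} (W : Fin m → Fin d → ℝ) : ℝ :=
  sSup {r : ℝ | ∃ x : Fin d → ℝ, l2norm x = 1 ∧ r = l2norm (mVec W x)}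

theorem l2norm_nonneg {d : ℕ} (v : Fin d → ℝ) : 0 ≤ l2norm v := Real.sqrt_nonneg _

theorem l2norm_sq {d : ℕ} (v : Fin d → ℝ) : l2norm v ^ 2 = ∑ j, v j ^ 2 :=
  Real.sq_sqrt (Finset.sum_nonneg fun _ _ => sq_nonneg _)

theorem l2norm_pos {d : ℕ} {v : Fin d → ℝ} (hv : v ≠ 0) : 0 < l2norm v := by
  obtain ⟨j, hj⟩ := Function.ne_iff.mp hv
  exact Real.sqrt_pos.mpr (Finset.sum_pos' (fun _ _ => sq_nonneg _)
    ⟨j, Finset.mem_univ j, sq_pos_of_ne_zero hj⟩)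

theorem l2norm_smul {d : ℕ} (c : ℝ) (v : Fin d → ℝ) : l2norm (c • v) = |c| * l2norm v := by
  simp only [l2norm, Pi.smul_apply, smul_eq_mul, mul_pow, ← Finset.mul_sum]
  rw [Real.sqrt_mul (sq_nonneg c), Real.sqrt_sq_eq_abs]

theorem mVec_smul {m d : ℕ} (W : Fin m → Fin d → ℝ) (c : ℝ) (z : Fin d → ℝ) :
    mVec W (c • z) = c • mVec W z := by
  ext r
  simp only [mVec, Pi.smul_apply, smul_eq_mul, Finset.mul_sum]
  exact Finset.sum_congr rfl fun _ _ => by ring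

/-- The Euclidean norm of `W z` is at most the Frobenius norm of `W` times that of `z`. -/
theorem l2norm_mVec_le_frobenius {m d : ℕ} (W : Fin m → Fin d → ℝ) (z : Fin d → ℝ) :
    l2norm (mVec W z) ≤ Real.sqrt (∑ r, ∑ s, W r s ^ 2) * l2norm z := by
  rw [l2norm, l2norm, ← Real.sqrt_mul (by positivity), Finset.sum_mul]
  exact Real.sqrt_le_sqrt (Finset.sum_le_sum fun r _ =>
    Finset.sum_mul_sq_le_sq_mul_sq Finset.univ (W r) z)

theorem opNorm2_nonneg {m d : ℕ} (W : Fin m → Fin d → ℝ) : 0 ≤ opNorm2 W :=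
  Real.sSup_nonneg (by rintro _ ⟨z, -, rfl⟩; exact l2norm_nonneg _)

theorem l2norm_mVec_le {m d : ℕ} (W : Fin m → Fin d → ℝ) (z : Fin d → ℝ) :
    l2norm (mVec W z) ≤ opNorm2 W * l2norm z := by
  rcases eq_or_ne z 0 with rfl | hz
  · simp [mVec, l2norm]
  have hpos := l2norm_pos hz
  have hunit : l2norm ((l2norm z)⁻¹ • z) = 1 := by
    rw [l2norm_smul, abs_of_pos (inv_pos.mpr hpos), inv_mul_cancel₀ hpos.ne']
  have hle : l2norm (mVec W ((l2norm z)⁻¹ • z)) ≤ opNorm2 W := by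
    refine le_csSup ⟨Real.sqrt (∑ r, ∑ s, W r s ^ 2), ?_⟩ ⟨_, hunit, rfl⟩
    rintro _ ⟨y, hy, rfl⟩
    simpa [hy] using l2norm_mVec_le_frobenius W y
  rwa [mVec_smul, l2norm_smul, abs_of_pos (inv_pos.mpr hpos), inv_mul_le_iff₀ hpos,
    mul_comm] at hle

/-- The transpose of `W` is bounded by the operator norm of `W`. -/
theorem l2norm_vecMul_le {m d : ℕ} (W : Fin m → Fin d → ℝ) (g : Fin m → ℝ) :
    l2norm (fun j => ∑ r, g r * W r j) ≤ opNorm2 W * l2norm g := by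
  set v : Fin d → ℝ := fun j => ∑ r, g r * W r j with hv
  rcases eq_or_ne v 0 with h0 | h0
  · rw [h0]
    simpa [l2norm] using mul_nonneg (opNorm2_nonneg W) (l2norm_nonneg g)
  have hpos := l2norm_pos h0
  have hinner : l2norm v ^ 2 = ∑ r, g r * mVec W v r := by
    rw [l2norm_sq]
    calc ∑ j, v j ^ 2 = ∑ j, ∑ r, g r * (W r j * v j) :=
          Finset.sum_congr rfl fun j _ => by
            rw [sq]
            nth_rewrite 1 [hv]
            simp only [Finset.sum_mul, mul_assoc]
      _ = ∑ r, g r * mVec W v r := by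
          rw [Finset.sum_comm]
          simp only [mVec, Finset.mul_sum]
  have hcs : ∑ r, g r * mVec W v r ≤ l2norm g * l2norm (mVec W v) :=
    Real.sum_mul_le_sqrt_mul_sqrt _ _ _
  have hop := mul_le_mul_of_nonneg_left (l2norm_mVec_le W v) (l2norm_nonneg g)
  refine le_of_mul_le_mul_right ?_ hpos
  nlinarith

/-- `mVec` as a continuous linear map in the vector. -/
noncomputable def mVecCLM {m d : ℕ} (W : Fin m → Fin d → ℝ) : (Fin d → ℝ) →L[ℝ] (Fin m → ℝ) :=
  LinearMap.toContinuousLinearMap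
    { toFun := mVec W
      map_add' := fun y z => by
        ext r
        simp [mVec, mul_add, Finset.sum_add_distrib]
      map_smul' := mVec_smul W }

/-- `mVec` as a continuous linear map in the matrix. -/
noncomputable def mVecFlipCLM {m d : ℕ} (x : Fin d → ℝ) :
    (Fin m → Fin d → ℝ) →L[ℝ] (Fin m → ℝ) :=
  LinearMap.toContinuousLinearMap
    { toFun := fun V => mVec V x
      map_add' := fun U V => by
        ext r
        simp [mVec, add_mul, Finset.sum_add_distrib]
      map_smul' := fun c V => by
        ext r
        simp [mVec, Finset.mul_sum, mul_assoc] }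

theorem mVec_single {m d : ℕ} (W : Fin m → Fin d → ℝ) (j : Fin d) :
    mVec W (Pi.single j 1) = fun r => W r j := by
  ext r
  simp [mVec, Pi.single_apply]

theorem mVec_single_single {m d : ℕ} (r : Fin m) (s : Fin d) (x : Fin d → ℝ) :
    mVec (Pi.single r (Pi.single s 1)) x = x s • Pi.single r 1 := by
  ext r'
  rcases eq_or_ne r' r with rfl | h
  · simp [mVec, Pi.single_apply]
  · simp [mVec, h]

/-- `‖∇_x f̃(W₁x, W₂)‖₂ ≤ (‖W₁‖₂ / ‖x‖₂) · ‖∇_{W₁} f̃(W₁x, W₂)‖₂`, where the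
gradient with respect to `W₁` is the gradient matrix of `V ↦ f̃(Vx, W₂)` at `V = W₁` flattened
entrywise. -/
theorem grad_x_le_opnorm_mul_grad_W1
    {m d p : ℕ}
    (ft : (Fin m → ℝ) → (Fin p → ℝ) → ℝ)
    (hft : Differentiable ℝ (fun q : (Fin m → ℝ) × (Fin p → ℝ) => ft q.1 q.2))
    (W1 : Fin m → Fin d → ℝ) (W2 : Fin p → ℝ)
    (x : Fin d → ℝ) (hx : x ≠ 0) :
    l2norm (fun j => fderiv ℝ (fun z => ft (mVec W1 z) W2) x (Pi.single j 1))
      ≤ (opNorm2 W1 / l2norm x) *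
        Real.sqrt (∑ r, ∑ s,
          (fderiv ℝ (fun V : Fin m → Fin d → ℝ => ft (mVec V x) W2) W1
            (Pi.single r (Pi.single s 1))) ^ 2) := by
  have hF : DifferentiableAt ℝ (fun u => ft u W2) (mVec W1 x) :=
    (hft (mVec W1 x, W2)).comp (f := fun u : Fin m → ℝ => (u, W2)) (mVec W1 x) (by fun_prop)
  set L := fderiv ℝ (fun u => ft u W2) (mVec W1 x)
  set g : Fin m → ℝ := fun r => L (Pi.single r 1) with hg
  have hz : fderiv ℝ (fun z => ft (mVec W1 z) W2) x = L.comp (mVecCLM W1) :=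
    (hF.hasFDerivAt.comp x (mVecCLM W1).hasFDerivAt).fderiv
  have hV : fderiv ℝ (fun V : Fin m → Fin d → ℝ => ft (mVec V x) W2) W1 =
      L.comp (mVecFlipCLM x) :=
    (HasFDerivAt.comp (f := fun V => mVec V x) W1 hF.hasFDerivAt
      (mVecFlipCLM x).hasFDerivAt).fderiv
  have hzj (j : Fin d) : L.comp (mVecCLM W1) (Pi.single j 1) = ∑ r, g r * W1 r j := by
    change L (mVec W1 (Pi.single j 1)) = _
    rw [mVec_single, pi_eq_sum_univ' (fun r => W1 r j), map_sum]
    refine Finset.sum_congr rfl fun r _ => ?_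
    rw [map_smul, smul_eq_mul, mul_comm, hg]
  have hVrs (r : Fin m) (s : Fin d) :
      L.comp (mVecFlipCLM x) (Pi.single r (Pi.single s 1)) = g r * x s := by
    change L (mVec (Pi.single r (Pi.single s 1)) x) = _
    rw [mVec_single_single, map_smul, smul_eq_mul, mul_comm]
  have hfrob : Real.sqrt (∑ r, ∑ s, (g r * x s) ^ 2) = l2norm g * l2norm x := by
    simp only [mul_pow, ← Finset.mul_sum, ← Finset.sum_mul]
    exact Real.sqrt_mul (Finset.sum_nonneg fun _ _ => sq_nonneg _) _
  simp only [hz, hV, hzj, hVrs]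
  rw [hfrob]
  have hpos := l2norm_pos hx
  calc l2norm (fun j => ∑ r, g r * W1 r j) ≤ opNorm2 W1 * l2norm g := l2norm_vecMul_le W1 g
    _ = opNorm2 W1 / l2norm x * (l2norm g * l2norm x) := by field_simp
end

section
/- Let a₁, …, aₙ ∈ ℝ^w with n ≥ 2, let Hᵢ = aᵢaᵢᵀ and H = (1/n) Σᵢ₌₁ⁿ Hᵢ, let η > 0 and 1 ≤ B ≤ n. Then the average over all B-element subsets 𝔍 ⊂ {1, …, n} of the Kronecker square satisfies the identity: (1/C(n,B)) Σ_𝔍 (I − (η/B) Σ_{i∈𝔍} Hᵢ) ⊗ (I − (η/B) Σ_{i∈𝔍} Hᵢ) = (I − ηH) ⊗ (I − ηH) + ((n − B)/(B(n − 1))) · (η²/n) Σᵢ₌₁ⁿ (Hᵢ ⊗ Hᵢ − H ⊗ H). -/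
open Finset Kronecker

/-- Double counting of the pairs `s ⊆ J ⊆ t` with `#J = k`. -/
theorem card_filter_powersetCard_subset_mul_choose {ι : Type*} [DecidableEq ι]
    (s t : Finset ι) (k : ℕ) (hst : s ⊆ t) :
    #{J ∈ t.powersetCard k | s ⊆ J} * (#t).choose #s = (#t).choose k * k.choose #s := by
  by_cases hsk : #s ≤ k
  · rw [card_filter_powersetCard_subset s t k hst hsk, Nat.choose_mul hsk, mul_comm]
  · rw [Nat.choose_eq_zero_of_lt (n := k) (by lia), filter_eq_empty_iff.2]
    · simp
    · intro J hJ hsJ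
      exact hsk ((card_le_card hsJ).trans_eq (mem_powersetCard.1 hJ).2)

/-- The mean over `k`-element subsets of a subset sum. -/
theorem card_mul_sum_powersetCard_sum {ι R : Type*} [Fintype ι] [CommRing R]
    (k : ℕ) (f : ι → R) :
    (Fintype.card ι : R) * ∑ J ∈ powersetCard k univ, ∑ i ∈ J, f i
      = (Fintype.card ι).choose k * (k * ∑ i, f i) := by
  classical
  have swap : ∑ J ∈ powersetCard k univ, ∑ i ∈ J, f i
      = ∑ i, (#{J ∈ powersetCard k univ | {i} ⊆ J} : R) * f i := by
    simp_rw [card_filter, Nat.cast_sum, sum_mul]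
    rw [sum_comm]
    refine sum_congr rfl fun J _ => ?_
    simp
  rw [swap, mul_sum, mul_sum, mul_sum]
  refine sum_congr rfl fun i _ => ?_
  have h := congrArg (Nat.cast (R := R))
    (card_filter_powersetCard_subset_mul_choose {i} univ k (subset_univ _))
  simp only [card_singleton, Nat.choose_one_right, card_univ, Nat.cast_mul] at h
  linear_combination f i * h

/-- The mean over `k`-element subsets of a product of two subset sums. -/
theorem card_mul_sum_powersetCard_sum_mul_sum {ι : Type*} [Fintype ι] (k : ℕ) (f g : ι → ℝ) :
    (Fintype.card ι * (Fintype.card ι - 1) : ℝ) *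
        ∑ J ∈ powersetCard k univ, (∑ i ∈ J, f i) * ∑ i ∈ J, g i
      = (Fintype.card ι).choose k *
          (k * (k - 1) * ((∑ i, f i) * ∑ i, g i)
            + k * (Fintype.card ι - k) * ∑ i, f i * g i) := by
  classical
  have swap : ∑ J ∈ powersetCard k univ, (∑ i ∈ J, f i) * ∑ i ∈ J, g i
      = ∑ i, ∑ j, (#{J ∈ powersetCard k univ | {i, j} ⊆ J} : ℝ) * (f i * g j) := by
    simp_rw [card_filter, Nat.cast_sum, sum_mul]
    simp_rw [sum_comm (t := powersetCard k univ)]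
    refine sum_congr rfl fun J _ => ?_
    simp_rw [insert_subset_iff, singleton_subset_iff, ite_and, mul_sum]
    simp
  have count (i j : ι) : (Fintype.card ι * (Fintype.card ι - 1) : ℝ) *
      #{J ∈ powersetCard k univ | {i, j} ⊆ J}
      = (Fintype.card ι).choose k *
        (k * (k - 1) + if i = j then (k * (Fintype.card ι - k) : ℝ) else 0) := by
    have h := congrArg (Nat.cast (R := ℝ))
      (card_filter_powersetCard_subset_mul_choose {i, j} univ k (subset_univ _))
    split_ifs with hij
    · subst hij
      simp only [pair_eq_singleton, card_singleton, Nat.choose_one_right, card_univ,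
        Nat.cast_mul] at h ⊢
      linear_combination (Fintype.card ι - 1 : ℝ) * h
    · simp only [card_pair hij, card_univ, Nat.cast_mul, Nat.cast_choose_two] at h
      linear_combination 2 * h
  rw [swap]
  simp_rw [mul_sum, ← mul_assoc _ _ (f _ * g _), count]
  simp_rw [mul_assoc, ← mul_sum, add_mul, sum_add_distrib, ite_mul, zero_mul,
    sum_ite_eq, mem_univ, if_true, sum_mul_sum, ← mul_assoc, ← mul_sum, mul_assoc, ← mul_sum]

/-- The average over size-`k` batches of a product of two affine batch means. -/
theorem batch_average_mul {ι : Type*} [Fintype ι] {k : ℕ} (hι : 2 ≤ Fintype.card ι)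
    (hk : 1 ≤ k) (hkι : k ≤ Fintype.card ι) (η u v : ℝ) (f g : ι → ℝ) :
    ((Fintype.card ι).choose k : ℝ)⁻¹ *
        ∑ J ∈ powersetCard k univ, (u - η / k * ∑ i ∈ J, f i) * (v - η / k * ∑ i ∈ J, g i)
      = (u - η * ((Fintype.card ι : ℝ)⁻¹ * ∑ i, f i))
          * (v - η * ((Fintype.card ι : ℝ)⁻¹ * ∑ i, g i))
        + ((Fintype.card ι - k : ℝ) / (k * (Fintype.card ι - 1)) * (η ^ 2 / Fintype.card ι)) *
          ∑ i, (f i * g i - ((Fintype.card ι : ℝ)⁻¹ * ∑ j, f j)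
            * ((Fintype.card ι : ℝ)⁻¹ * ∑ j, g j)) := by
  have hf := card_mul_sum_powersetCard_sum k f
  have hg := card_mul_sum_powersetCard_sum k g
  have hfg := card_mul_sum_powersetCard_sum_mul_sum k f g
  have expand : ∑ J ∈ powersetCard k univ,
        (u - η / k * ∑ i ∈ J, f i) * (v - η / k * ∑ i ∈ J, g i)
      = (Fintype.card ι).choose k * (u * v)
        - η / k * v * ∑ J ∈ powersetCard k univ, ∑ i ∈ J, f i
        - η / k * u * ∑ J ∈ powersetCard k univ, ∑ i ∈ J, g i
        + (η / k) ^ 2 * ∑ J ∈ powersetCard k univ, (∑ i ∈ J, f i) * ∑ i ∈ J, g i := by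
    rw [← card_univ, ← card_powersetCard, ← nsmul_eq_mul, ← sum_const, mul_sum, mul_sum, mul_sum,
      ← sum_sub_distrib, ← sum_sub_distrib, ← sum_add_distrib]
    exact sum_congr rfl fun J _ => by ring
  rw [expand, sum_sub_distrib, sum_const, card_univ, nsmul_eq_mul]
  have hC : ((Fintype.card ι).choose k : ℝ) ≠ 0 := by
    exact_mod_cast (Nat.choose_pos hkι).ne'
  have hn : (2 : ℝ) ≤ Fintype.card ι := by exact_mod_cast hι
  have hn0 : (Fintype.card ι : ℝ) ≠ 0 := by positivity
  have hn1 : (Fintype.card ι : ℝ) - 1 ≠ 0 := by linarith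
  have hk0 : (k : ℝ) ≠ 0 := by exact_mod_cast (by lia : k ≠ 0)
  rw [eq_div_of_mul_eq hn0 ((mul_comm _ _).trans hf),
    eq_div_of_mul_eq hn0 ((mul_comm _ _).trans hg),
    eq_div_of_mul_eq (mul_ne_zero hn0 hn1) ((mul_comm _ _).trans hfg)]
  field_simp
  ring



/-- the batch average of the Kronecker square of `I − (η/B) Σ_{i∈𝔍} Hᵢ`
equals `(I − ηH)⊗(I − ηH) + ((n−B)/(B(n−1))) (η²/n) Σᵢ (Hᵢ⊗Hᵢ − H⊗H)`. -/
theorem kronecker_square_batch_average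
    {n w : ℕ} (hn : 2 ≤ n) (B : ℕ) (hB : 1 ≤ B) (hBn : B ≤ n)
    (η : ℝ) (hη : 0 < η) (a : Fin n → Fin w → ℝ) :
    ((n.choose B : ℝ))⁻¹ •
        ∑ J ∈ Finset.powersetCard B (Finset.univ : Finset (Fin n)),
          (((1 : Matrix (Fin w) (Fin w) ℝ)
              - (η / (B : ℝ)) • ∑ i ∈ J, Matrix.vecMulVec (a i) (a i)) ⊗ₖ
            ((1 : Matrix (Fin w) (Fin w) ℝ)
              - (η / (B : ℝ)) • ∑ i ∈ J, Matrix.vecMulVec (a i) (a i)))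
      = (((1 : Matrix (Fin w) (Fin w) ℝ)
            - η • ((n : ℝ)⁻¹ • ∑ i, Matrix.vecMulVec (a i) (a i))) ⊗ₖ
          ((1 : Matrix (Fin w) (Fin w) ℝ)
            - η • ((n : ℝ)⁻¹ • ∑ i, Matrix.vecMulVec (a i) (a i))))
        + ((((n : ℝ) - (B : ℝ)) / ((B : ℝ) * ((n : ℝ) - 1))) * (η ^ 2 / (n : ℝ))) •
            ∑ i, (Matrix.vecMulVec (a i) (a i) ⊗ₖ Matrix.vecMulVec (a i) (a i)
              - ((n : ℝ)⁻¹ • ∑ i', Matrix.vecMulVec (a i') (a i')) ⊗ₖ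
                  ((n : ℝ)⁻¹ • ∑ i', Matrix.vecMulVec (a i') (a i'))) := by
  ext ⟨p, q⟩ ⟨r, s⟩
  have h := batch_average_mul (ι := Fin n) (by simpa using hn) hB (by simpa using hBn) η
    ((1 : Matrix (Fin w) (Fin w) ℝ) p r) ((1 : Matrix (Fin w) (Fin w) ℝ) q s)
    (fun i => Matrix.vecMulVec (a i) (a i) p r) (fun i => Matrix.vecMulVec (a i) (a i) q s)
  simp only [Fintype.card_fin] at h
  simpa only [Matrix.add_apply, Matrix.sub_apply, Matrix.smul_apply, Matrix.sum_apply,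
    Matrix.kroneckerMap_apply, smul_eq_mul] using h
end
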